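/- Let Ω ⊆ ℝ^n be a bounded open set, let u ∈ C_c^∞(Ω), and let u₁ > 0 be a smooth Dirichlet eigenfunction of −Δ on Ω with eigenvalue λ₁ > 0 (i.e. −Δu₁ = λ₁u₁, u₁ > 0 on Ω). Then for every positive integer m: ∫_Ω |Δ^m u|² dx − λ₁^{2m} ∫_Ω u² dx = Σ_{j=0}^{m−1} λ₁^{2(m−1−j)} ( ∫_Ω |Δ^{j+1}u + λ₁ Δ^j u|² dx + 2λ₁ ∫_Ω |∇Δ^j u − (∇u₁/u₁) Δ^j u|² dx ), and in particular ∫_Ω |Δ^m u|² dx ≥ λ₁^{2m} ∫_Ω u² dx. -/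

import Mathlib

open MeasureTheory Finset
open scoped RealInnerProductSpace

noncomputable def grad {n : ℕ} (f : EuclideanSpace ℝ (Fin n) → ℝ) :
    EuclideanSpace ℝ (Fin n) → EuclideanSpace ℝ (Fin n) :=
  fun x => gradient f x

noncomputable def dvg {n : ℕ} (V : EuclideanSpace ℝ (Fin n) → EuclideanSpace ℝ (Fin n)) :
    EuclideanSpace ℝ (Fin n) → ℝ :=
  fun x => ∑ i, fderiv ℝ V x (EuclideanSpace.single i 1) i

noncomputable def lap {n : ℕ} (f : EuclideanSpace ℝ (Fin n) → ℝ) :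
    EuclideanSpace ℝ (Fin n) → ℝ :=
  dvg (grad f)

open scoped ContDiff in
lemma grad_contDiffAt {n : ℕ} {f : EuclideanSpace ℝ (Fin n) → ℝ} {x : EuclideanSpace ℝ (Fin n)}
    (hf : ContDiffAt ℝ ∞ f x) : ContDiffAt ℝ ∞ (grad f) x := by
  have h1 : ContDiffAt ℝ ∞ (fderiv ℝ f) x := hf.fderiv_right (by norm_cast)
  exact ((InnerProductSpace.toDual ℝ (EuclideanSpace ℝ (Fin n))).symm.toContinuousLinearEquiv.contDiff.contDiffAt).comp x h1

lemma grad_apply {n : ℕ} (f : EuclideanSpace ℝ (Fin n) → ℝ) (x : EuclideanSpace ℝ (Fin n))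
    (i : Fin n) : grad f x i = fderiv ℝ f x (EuclideanSpace.single i 1) := by
  have h : inner ℝ (gradient f x) (EuclideanSpace.single i (1:ℝ))
      = fderiv ℝ f x (EuclideanSpace.single i 1) := by
    unfold gradient
    rw [InnerProductSpace.toDual_symm_apply]
  rw [← h, EuclideanSpace.inner_single_right]
  simp [grad]

open scoped ContDiff in
lemma dvg_contDiff {n : ℕ} {V : EuclideanSpace ℝ (Fin n) → EuclideanSpace ℝ (Fin n)}
    (hV : ContDiff ℝ ∞ V) : ContDiff ℝ ∞ (dvg V) := by
  have h1 : ContDiff ℝ ∞ (fderiv ℝ V) := hV.fderiv_right (by norm_cast)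
  unfold dvg
  refine ContDiff.sum fun i _ => ?_
  have h2 : ContDiff ℝ ∞ (fun x => fderiv ℝ V x (EuclideanSpace.single i 1)) :=
    h1.clm_apply contDiff_const
  exact (EuclideanSpace.proj (𝕜 := ℝ) i).contDiff.comp h2

lemma tsupport_grad {n : ℕ} (f : EuclideanSpace ℝ (Fin n) → ℝ) :
    tsupport (grad f) ⊆ tsupport f := by
  refine closure_minimal (fun x hx => ?_) (isClosed_tsupport f)
  refine support_fderiv_subset ℝ (f := f) ?_
  intro h
  apply hx
  simp [grad, gradient, h]

lemma tsupport_dvg {n : ℕ} (V : EuclideanSpace ℝ (Fin n) → EuclideanSpace ℝ (Fin n)) :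
    tsupport (dvg V) ⊆ tsupport V := by
  refine closure_minimal (fun x hx => ?_) (isClosed_tsupport V)
  refine support_fderiv_subset ℝ (f := V) ?_
  intro h
  apply hx
  simp [dvg, h]

lemma integral_dvg {n : ℕ} {V : EuclideanSpace ℝ (Fin n) → EuclideanSpace ℝ (Fin n)}
    (hV : ContDiff ℝ (⊤ : ℕ∞) V) (hc : HasCompactSupport V) : ∫ x, dvg V x = 0 := by
  have h1 : ContDiff ℝ (⊤ : ℕ∞) (fderiv ℝ V) := hV.fderiv_right (by norm_cast)
  have key : ∀ i : Fin n,
      Integrable (fun x => fderiv ℝ V x (EuclideanSpace.single i 1) i) ∧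
      ∫ x, fderiv ℝ V x (EuclideanSpace.single i 1) i = 0 := by
    intro i
    have hd : ∀ x, HasFDerivAt (fun x => V x i)
        ((EuclideanSpace.proj (𝕜 := ℝ) i).comp (fderiv ℝ V x)) x := fun x =>
      (EuclideanSpace.proj (𝕜 := ℝ) i).hasFDerivAt.comp x
        ((hV.differentiable (by simp)) x).hasFDerivAt
    have hint : Integrable (fun x => fderiv ℝ V x (EuclideanSpace.single i 1) i) := by
      apply Continuous.integrable_of_hasCompactSupport
      · exact (EuclideanSpace.proj (𝕜 := ℝ) i).continuous.comp
          (h1.continuous.clm_apply continuous_const)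
      · exact (hc.fderiv (𝕜 := ℝ)).comp_left (g := fun L => L (EuclideanSpace.single i 1) i)
          (by simp)
    refine ⟨hint, ?_⟩
    have hVi : Integrable (fun x => V x i) := by
      apply Continuous.integrable_of_hasCompactSupport
      · exact (EuclideanSpace.proj (𝕜 := ℝ) i).continuous.comp hV.continuous
      · exact hc.comp_left (g := fun y => y i) (by simp)
    have he : ∀ x, fderiv ℝ (fun x => V x i) x (EuclideanSpace.single i 1)
        = fderiv ℝ V x (EuclideanSpace.single i 1) i := by
      intro x; rw [(hd x).fderiv]; simp
    have := integral_mul_fderiv_eq_neg_fderiv_mul_of_integrable (𝕜 := ℝ) (μ := volume)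
      (f := fun _ : EuclideanSpace ℝ (Fin n) => (1:ℝ)) (g := fun x => V x i)
      (v := EuclideanSpace.single i 1) (by simp) (by simpa [he] using hint)
      (by simpa using hVi) (by fun_prop) (fun x _ => (hd x).differentiableAt)
    simpa [he] using this
  unfold dvg
  rw [integral_finsetSum _ fun i _ => (key i).1]
  exact Finset.sum_eq_zero fun i _ => (key i).2

lemma dvg_smul_sub {n : ℕ} {f g : EuclideanSpace ℝ (Fin n) → ℝ}
    {V W : EuclideanSpace ℝ (Fin n) → EuclideanSpace ℝ (Fin n)} {x : EuclideanSpace ℝ (Fin n)}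
    (hf : DifferentiableAt ℝ f x) (hg : DifferentiableAt ℝ g x)
    (hV : DifferentiableAt ℝ V x) (hW : DifferentiableAt ℝ W x) :
    dvg (fun x => f x • V x - g x • W x) x =
      (f x * dvg V x + ∑ i, fderiv ℝ f x (EuclideanSpace.single i 1) * V x i)
      - (g x * dvg W x + ∑ i, fderiv ℝ g x (EuclideanSpace.single i 1) * W x i) := by
  have h := (hf.hasFDerivAt.smul hV.hasFDerivAt).sub (hg.hasFDerivAt.smul hW.hasFDerivAt)
  unfold dvg
  have h' : fderiv ℝ (fun x => f x • V x - g x • W x) x = _ := h.fderiv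
  rw [h']
  simp only [Finset.mul_sum, ← Finset.sum_add_distrib, ← Finset.sum_sub_distrib]
  refine Finset.sum_congr rfl fun i _ => ?_
  simp

lemma pointwise_id {n : ℕ} {v w : EuclideanSpace ℝ (Fin n) → ℝ} {x : EuclideanSpace ℝ (Fin n)}
    (hv : ContDiffAt ℝ (⊤ : ℕ∞) v x) (hw : ContDiffAt ℝ (⊤ : ℕ∞) w x) (hpos : 0 < w x) (lam : ℝ)
    (heig : -(lap w x) = lam * w x) :
    ‖grad v x - (v x / w x) • grad w x‖ ^ 2 =
      dvg (fun x => v x • grad v x - (v x ^ 2 / w x) • grad w x) x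
        - v x * lap v x - lam * v x ^ 2 := by
  have hvd : DifferentiableAt ℝ v x := hv.differentiableAt (by simp)
  have hwd : DifferentiableAt ℝ w x := hw.differentiableAt (by simp)
  have hne := hpos.ne'
  have hg : HasFDerivAt (fun x => v x ^ 2 / w x)
      ((2 * v x / w x) • fderiv ℝ v x - (v x ^ 2 / w x ^ 2) • fderiv ℝ w x) x := by
    have h1 := (hvd.hasFDerivAt.pow 2).mul ((hasDerivAt_inv hne).comp_hasFDerivAt x hwd.hasFDerivAt)
    refine (h1.congr_fderiv ?_)
    ext y
    simp
    field_simp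
    ring
  rw [dvg_smul_sub hvd hg.differentiableAt ((grad_contDiffAt hv).differentiableAt (by simp))
    ((grad_contDiffAt hw).differentiableAt (by simp)), hg.fderiv]
  have hl : dvg (grad w) x = -(lam * w x) := by rw [← heig]; simp [lap]
  rw [hl, EuclideanSpace.norm_sq_eq]
  simp only [lap, grad_apply, PiLp.sub_apply, PiLp.smul_apply, Real.norm_eq_abs, sq_abs,
    smul_eq_mul, sub_apply, smul_apply]
  have e : ∀ S T D : ℝ, v x * D + S - (v x ^ 2 / w x * -(lam * w x) + T) - v x * D - lam * v x ^ 2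
      = S - T := by
    intro S T D; field_simp; ring
  rw [e, ← Finset.sum_sub_distrib]
  refine Finset.sum_congr rfl fun i _ => ?_
  field_simp
  ring

lemma integrable_mul_aux {n : ℕ} {f g : EuclideanSpace ℝ (Fin n) → ℝ}
    (hf : Continuous f) (hg : Continuous g) (hc : HasCompactSupport f) :
    Integrable (fun x => f x * g x) := by
  have h1 : Continuous (fun x => f x * g x) := by fun_prop
  have h2 : HasCompactSupport (fun x => f x * g x) := hc.mul_right
  exact h1.integrable_of_hasCompactSupport h2

lemma step_id {n : ℕ} {Ω : Set (EuclideanSpace ℝ (Fin n))} (hΩ : IsOpen Ω)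
    {v w : EuclideanSpace ℝ (Fin n) → ℝ}
    (hv : ContDiff ℝ (⊤ : ℕ∞) v) (hc : HasCompactSupport v) (hsub : tsupport v ⊆ Ω)
    (hw : ContDiffOn ℝ (⊤ : ℕ∞) w Ω) (hpos : ∀ x ∈ Ω, 0 < w x) (lam : ℝ)
    (heig : ∀ x ∈ Ω, -(lap w x) = lam * w x) :
    (∫ x in Ω, (lap v x) ^ 2) - lam ^ 2 * (∫ x in Ω, v x ^ 2) =
      (∫ x in Ω, (lap v x + lam * v x) ^ 2) +
        2 * lam * ∫ x in Ω, ‖grad v x - (v x / w x) • grad w x‖ ^ 2 := by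
  obtain ⟨W, hWdef⟩ : ∃ W : EuclideanSpace ℝ (Fin n) → EuclideanSpace ℝ (Fin n),
    W = fun x => v x • grad v x - (v x ^ 2 / w x) • grad w x := ⟨_, rfl⟩
  have hsW : tsupport W ⊆ tsupport v := by
    refine closure_minimal (fun x hx => ?_) (isClosed_tsupport v)
    by_contra h
    have := image_eq_zero_of_notMem_tsupport h
    apply hx
    simp [hWdef, this]
  have hWc : HasCompactSupport W := hc.mono' (subset_trans subset_closure hsW)
  have hW : ContDiff ℝ (⊤ : ℕ∞) W := by
    refine contDiff_iff_contDiffAt.2 fun x => ?_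
    by_cases hx : x ∈ tsupport W
    swap
    · exact (contDiffAt_const (c := 0)).congr_of_eventuallyEq (notMem_tsupport_iff_eventuallyEq.1 hx)
    have hxΩ := hsub (hsW hx)
    have hwx : ContDiffAt ℝ (⊤ : ℕ∞) w x := hw.contDiffAt (hΩ.mem_nhds hxΩ)
    rw [hWdef]
    exact (hv.contDiffAt.smul (grad_contDiffAt hv.contDiffAt)).sub
      (((hv.contDiffAt.pow 2).div hwx (hpos x hxΩ).ne').smul (grad_contDiffAt hwx))
  have hlap : ContDiff ℝ (⊤ : ℕ∞) (lap v) :=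
    dvg_contDiff (contDiff_iff_contDiffAt.2 fun x => grad_contDiffAt hv.contDiffAt)
  have hlc : HasCompactSupport (lap v) :=
    hc.mono' (subset_trans subset_closure ((tsupport_dvg _).trans (tsupport_grad v)))
  have hdW : ∫ x in Ω, dvg W x = 0 := by
    rw [setIntegral_eq_integral_of_forall_compl_eq_zero, integral_dvg hW hWc]
    intro x hx
    exact image_eq_zero_of_notMem_tsupport fun h => hx (hsub (hsW (tsupport_dvg W h)))
  have i1 : Integrable (fun x => lap v x ^ 2) := by
    simp only [pow_two]
    exact integrable_mul_aux hlap.continuous hlap.continuous hlc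
  have i2 : Integrable (fun x => v x ^ 2) := by
    simp only [pow_two]
    exact integrable_mul_aux hv.continuous hv.continuous hc
  have i3 : Integrable (fun x => v x * lap v x) :=
    integrable_mul_aux hv.continuous hlap.continuous hc
  have i4 : Integrable (dvg W) :=
    (dvg_contDiff hW).continuous.integrable_of_hasCompactSupport
      (hWc.mono' (subset_trans subset_closure (tsupport_dvg W)))
  have e1 : ∫ x in Ω, ‖grad v x - (v x / w x) • grad w x‖ ^ 2 =
      ∫ x in Ω, (dvg W x - v x * lap v x - lam * v x ^ 2) :=
    setIntegral_congr_fun hΩ.measurableSet fun x hx => by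
      rw [hWdef]
      exact pointwise_id hv.contDiffAt (hw.contDiffAt (hΩ.mem_nhds hx)) (hpos x hx) lam (heig x hx)
  have e2 : ∫ x in Ω, (lap v x + lam * v x) ^ 2 =
      ∫ x in Ω, (lap v x ^ 2 + (2 * lam) * (v x * lap v x) + lam ^ 2 * v x ^ 2) := by
    congr 1; ext x; ring
  have j1 := i1.integrableOn (s := Ω)
  have j2 := i2.integrableOn (s := Ω)
  have j3 := i3.integrableOn (s := Ω)
  have j4 := i4.integrableOn (s := Ω)
  have k1 : Integrable (fun x => dvg W x - v x * lap v x) (volume.restrict Ω) := j4.sub j3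
  have k2 : Integrable (fun x => lap v x ^ 2 + (2 * lam) * (v x * lap v x)) (volume.restrict Ω) :=
    Integrable.add j1 (Integrable.const_mul j3 (2 * lam))
  rw [e1, e2, integral_sub k1 (j2.const_mul _), integral_sub j4 j3,
    integral_add k2 (j2.const_mul _), integral_add j1 (j3.const_mul _)]
  simp only [integral_const_mul, hdW]
  ring

lemma iter_props {n : ℕ} {u : EuclideanSpace ℝ (Fin n) → ℝ}
    (hu : ContDiff ℝ (⊤ : ℕ∞) u) (j : ℕ) :
    ContDiff ℝ (⊤ : ℕ∞) (lap^[j] u) ∧ tsupport (lap^[j] u) ⊆ tsupport u := by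
  induction j with
  | zero => exact ⟨hu, subset_rfl⟩
  | succ j ih =>
    rw [Function.iterate_succ_apply']
    exact ⟨dvg_contDiff (contDiff_iff_contDiffAt.2 fun x => grad_contDiffAt ih.1.contDiffAt),
      ((tsupport_dvg _).trans (tsupport_grad _)).trans ih.2⟩

lemma telescope (T S : ℕ → ℝ) (lam : ℝ) (h : ∀ j, T (j + 1) - lam ^ 2 * T j = S j) (m : ℕ) :
    T m - lam ^ (2 * m) * T 0 = ∑ j ∈ Finset.range m, lam ^ (2 * (m - 1 - j)) * S j := by
  induction m with
  | zero => simp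
  | succ m ih =>
    rw [Finset.sum_range_succ]
    have : ∑ j ∈ Finset.range m, lam ^ (2 * (m + 1 - 1 - j)) * S j
        = lam ^ 2 * ∑ j ∈ Finset.range m, lam ^ (2 * (m - 1 - j)) * S j := by
      rw [Finset.mul_sum]
      refine Finset.sum_congr rfl fun j hj => ?_
      have hj' := Finset.mem_range.1 hj
      rw [show 2 * (m + 1 - 1 - j) = 2 + 2 * (m - 1 - j) by omega, pow_add]
      ring
    rw [this, ← ih, ← h m]
    simp
    ring

theorem stmt4 {n : ℕ} (Ω : Set (EuclideanSpace ℝ (Fin n)))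
    (hΩ : IsOpen Ω) (hΩb : Bornology.IsBounded Ω)
    (u u₁ : EuclideanSpace ℝ (Fin n) → ℝ)
    (hu : ContDiff ℝ (⊤ : ℕ∞) u) (husupp : HasCompactSupport u) (husub : tsupport u ⊆ Ω)
    (hu₁ : ContDiffOn ℝ (⊤ : ℕ∞) u₁ Ω) (hu₁pos : ∀ x ∈ Ω, 0 < u₁ x)
    (lam : ℝ) (hlam : 0 < lam)
    (heig : ∀ x ∈ Ω, -(lap u₁ x) = lam * u₁ x)
    (m : ℕ) (hm : 1 ≤ m) :
    ((∫ x in Ω, (lap^[m] u x) ^ 2) - lam ^ (2 * m) * ∫ x in Ω, (u x) ^ 2 =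
      ∑ j ∈ Finset.range m, lam ^ (2 * (m - 1 - j)) *
        ((∫ x in Ω, (lap^[j + 1] u x + lam * lap^[j] u x) ^ 2) +
          2 * lam * ∫ x in Ω,
            ‖grad (lap^[j] u) x - (lap^[j] u x / u₁ x) • grad u₁ x‖ ^ 2)) ∧
    lam ^ (2 * m) * (∫ x in Ω, (u x) ^ 2) ≤ ∫ x in Ω, (lap^[m] u x) ^ 2 := by
  have hstep := fun j => step_id hΩ (iter_props hu j).1
    (husupp.mono' (subset_trans subset_closure (iter_props hu j).2))
    ((iter_props hu j).2.trans husub) hu₁ hu₁pos lam heig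
  have key := telescope (fun j => ∫ x in Ω, (lap^[j] u x) ^ 2)
    (fun j => (∫ x in Ω, (lap^[j + 1] u x + lam * lap^[j] u x) ^ 2) +
          2 * lam * ∫ x in Ω,
            ‖grad (lap^[j] u) x - (lap^[j] u x / u₁ x) • grad u₁ x‖ ^ 2) lam
    (fun j => by simpa only [Function.iterate_succ_apply'] using hstep j) m
  refine ⟨key, ?_⟩
  rw [← sub_nonneg]
  refine le_of_le_of_eq ?_ key.symm
  refine Finset.sum_nonneg fun j _ => mul_nonneg (by positivity) (add_nonneg ?_ (mul_nonneg (by positivity) ?_))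
  · exact integral_nonneg fun x => sq_nonneg _
  · exact integral_nonneg fun x => sq_nonneg _
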